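/- arXiv:2203.09342 — 2 statements merged into one kernel-verified Lean document; each statement's English description precedes it below -/
import Mathlib

section
/- Assume n > 2. Every S_n-invariant element of A_f that lies in Algebra.adjoin A {τ_{n−1}} (the A-subalgebra generated by the last universal root) lies in the image of algebraMap A A_f. -/
open MvPolynomial

noncomputable section

/-- The ideal defining the splitting algebra of `f = Xⁿ + a₁Xⁿ⁻¹ + ⋯ + aₙ`. -/
def splittingIdeal (A : Type*) [CommRing A] (n : ℕ) (a : Fin n → A) :
    Ideal (MvPolynomial (Fin n) A) :=
  Ideal.span (Set.range fun k : Fin n =>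
    esymm (Fin n) A (k.1 + 1) - C ((-1 : A) ^ (k.1 + 1) * a k))

/-- The splitting algebra `A_f`. -/
abbrev SplittingAlg (A : Type*) [CommRing A] (n : ℕ) (a : Fin n → A) : Type _ :=
  MvPolynomial (Fin n) A ⧸ splittingIdeal A n a

/-- The quotient map `π`. -/
def splittingMk (A : Type*) [CommRing A] (n : ℕ) (a : Fin n → A) :
    MvPolynomial (Fin n) A →ₐ[A] SplittingAlg A n a :=
  Ideal.Quotient.mkₐ A (splittingIdeal A n a)

/-- The universal roots `τᵢ`. -/
def tau (A : Type*) [CommRing A] (n : ℕ) (a : Fin n → A) (i : Fin n) :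
    SplittingAlg A n a :=
  splittingMk A n a (X i)

theorem rename_mem_splittingIdeal (A : Type*) [CommRing A] (n : ℕ) (a : Fin n → A)
    (σ : Equiv.Perm (Fin n)) {p : MvPolynomial (Fin n) A}
    (hp : p ∈ splittingIdeal A n a) :
    rename (σ : Fin n → Fin n) p ∈ splittingIdeal A n a := by
  have h : (splittingIdeal A n a).map ((rename (σ : Fin n → Fin n)).toRingHom :
      MvPolynomial (Fin n) A →+* MvPolynomial (Fin n) A) ≤ splittingIdeal A n a := by
    rw [splittingIdeal, Ideal.map_span]
    refine Ideal.span_le.2 ?_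
    rintro _ ⟨_, ⟨k, rfl⟩, rfl⟩
    have hren : (rename (σ : Fin n → Fin n))
        (esymm (Fin n) A (k.1 + 1) - C ((-1 : A) ^ (k.1 + 1) * a k))
        = esymm (Fin n) A (k.1 + 1) - C ((-1 : A) ^ (k.1 + 1) * a k) := by
      rw [map_sub, esymm_isSymmetric (Fin n) A (k.1 + 1) σ, rename_C]
    show (rename (σ : Fin n → Fin n))
        (esymm (Fin n) A (k.1 + 1) - C ((-1 : A) ^ (k.1 + 1) * a k)) ∈ _
    rw [hren]
    exact Ideal.subset_span ⟨k, rfl⟩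
  exact h (Ideal.mem_map_of_mem _ hp)

/-- The action of a permutation `σ` on the splitting algebra, as an `A`-algebra map. -/
def permHom (A : Type*) [CommRing A] (n : ℕ) (a : Fin n → A) (σ : Equiv.Perm (Fin n)) :
    SplittingAlg A n a →ₐ[A] SplittingAlg A n a :=
  Ideal.Quotient.liftₐ (splittingIdeal A n a)
    ((splittingMk A n a).comp (rename (σ : Fin n → Fin n)))
    (fun p hp => by
      have h := rename_mem_splittingIdeal A n a σ hp
      show Ideal.Quotient.mkₐ A (splittingIdeal A n a) _ = 0
      rw [Ideal.Quotient.mkₐ_eq_mk]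
      exact (Ideal.Quotient.eq_zero_iff_mem).2 h)

/-- The trivial `G`-invariants of the splitting algebra. -/
def trivialInv (A : Type*) [CommRing A] (n : ℕ) (a : Fin n → A)
    (G : Subgroup (Equiv.Perm (Fin n))) : Set (SplittingAlg A n a) :=
  splittingMk A n a '' {p | ∀ σ ∈ G, rename (σ : Fin n → Fin n) p = p}

/-- The element `D_f = ∏_{i<j} (τᵢ + τⱼ)`. -/
def Df (A : Type*) [CommRing A] (n : ℕ) (a : Fin n → A) : SplittingAlg A n a :=
  ∏ p ∈ Finset.univ.filter (fun p : Fin n × Fin n => p.1 < p.2),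
    (tau A n a p.1 + tau A n a p.2)

end

/-- The monic polynomial `Xⁿ + a₁Xⁿ⁻¹ + ⋯ + aₙ`. -/
noncomputable def monicOfCoeffs {A : Type*} [CommRing A] {n : ℕ} (a : Fin n → A) :
    Polynomial A :=
  Polynomial.X ^ n + ∑ k : Fin n, Polynomial.C (a k) * Polynomial.X ^ (n - (k.1 + 1))

section monicOfCoeffs

variable {A : Type*} [CommRing A] {n : ℕ} (a : Fin n → A)

theorem degree_sum_lt_of_coeffs :
    (∑ k : Fin n, Polynomial.C (a k) * Polynomial.X ^ (n - (k.1 + 1))).degree <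
      (n : WithBot ℕ) := by
  refine (Polynomial.degree_sum_le _ _).trans_lt ?_
  refine (Finset.sup_lt_iff (WithBot.bot_lt_coe n)).2 fun k _ => ?_
  refine (Polynomial.degree_C_mul_X_pow_le _ _).trans_lt ?_
  exact WithBot.coe_lt_coe.2 (Nat.sub_lt (Fin.pos k) (Nat.succ_pos _))

theorem monicOfCoeffs_monic : (monicOfCoeffs a).Monic :=
  Polynomial.monic_X_pow_add (degree_sum_lt_of_coeffs a)

theorem natDegree_monicOfCoeffs [Nontrivial A] : (monicOfCoeffs a).natDegree = n := by
  refine Polynomial.natDegree_eq_of_degree_eq_some ?_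
  rw [monicOfCoeffs, Polynomial.degree_add_eq_left_of_degree_lt] <;>
    rw [Polynomial.degree_X_pow]
  exact degree_sum_lt_of_coeffs a

theorem coeff_monicOfCoeffs (k : Fin n) : (monicOfCoeffs a).coeff (n - (k.1 + 1)) = a k := by
  rw [monicOfCoeffs, Polynomial.coeff_add, Polynomial.coeff_X_pow, if_neg (by omega), zero_add,
    Polynomial.finsetSum_coeff, Finset.sum_eq_single k]
  · simp
  · intro j _ hj
    rw [Polynomial.coeff_C_mul_X_pow, if_neg]
    exact fun h => hj (Fin.ext (by omega))
  · simp

variable {R : Type*} [CommRing R] [Algebra A R] {a}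

/-- Vieta's formulas: a family satisfying the defining relations of the splitting algebra is a
full family of roots. -/
theorem prod_X_sub_C_eq_map_of_esymm {ρ : Fin n → R}
    (h : ∀ k : Fin n, aeval ρ (esymm (Fin n) A (k.1 + 1)) =
      algebraMap A R ((-1) ^ (k.1 + 1) * a k)) :
    ∏ i, (Polynomial.X - Polynomial.C (ρ i)) = (monicOfCoeffs a).map (algebraMap A R) := by
  have hv := Multiset.prod_X_sub_X_eq_sum_esymm (Finset.univ.val.map ρ)
  rw [Multiset.map_map] at hv
  refine hv.trans ?_
  rw [Finset.sum_range_succ', add_comm]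
  simp only [Multiset.card_map, Finset.card_val, Finset.card_univ, Fintype.card_fin]
  simp only [monicOfCoeffs, Polynomial.map_add, Polynomial.map_sum, Polynomial.map_pow,
    Polynomial.map_mul, Polynomial.map_X, Polynomial.map_C]
  congr 1
  · simp [Multiset.esymm]
  · rw [Finset.sum_range]
    refine Finset.sum_congr rfl fun k _ => ?_
    rw [← aeval_esymm_eq_multiset_esymm (Fin n) A, h k, ← mul_assoc]
    congr 1
    simp only [map_mul, map_pow, map_neg, map_one]
    rw [← mul_assoc, ← mul_pow]
    simp

/-- Vieta's formulas: a full family of roots satisfies the defining relations of the splitting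
algebra. -/
theorem aeval_esymm_of_prod_X_sub_C_eq_map {ρ : Fin n → R}
    (h : ∏ i, (Polynomial.X - Polynomial.C (ρ i)) = (monicOfCoeffs a).map (algebraMap A R))
    (k : Fin n) :
    aeval ρ (esymm (Fin n) A (k.1 + 1)) = algebraMap A R ((-1) ^ (k.1 + 1) * a k) := by
  have hv := Multiset.prod_X_sub_C_coeff (Finset.univ.val.map ρ) (k := n - (k.1 + 1)) (by simp)
  rw [Multiset.map_map] at hv
  replace hv := (congrArg (Polynomial.coeff · (n - (k.1 + 1))) h).symm.trans hv
  simp only [Polynomial.coeff_map, coeff_monicOfCoeffs, Multiset.card_map, Finset.card_val,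
    Finset.card_univ, Fintype.card_fin, Nat.sub_sub_self (Nat.succ_le_of_lt k.2)] at hv
  rw [aeval_esymm_eq_multiset_esymm, map_mul, hv, map_pow, map_neg, map_one, ← mul_assoc,
    ← mul_pow]
  simp

end monicOfCoeffs

section splitting

open Polynomial

theorem AdjoinRoot.of_injective_of_monic {R : Type*} [CommRing R] {f : R[X]} (hf : f.Monic)
    (h : 0 < f.natDegree) : Function.Injective (AdjoinRoot.of f) := by
  refine (injective_iff_map_eq_zero _).2 fun r hr => ?_
  by_contra hr0
  exact AdjoinRoot.mk_ne_zero_of_natDegree_lt hf (Polynomial.C_ne_zero.2 hr0) (by simpa) hr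

/-- A polynomial of degree less than `deg f` that takes the same value at two generic roots of
`f` is constant. -/
theorem eq_C_of_dvd_map_sub_C_eval {A : Type*} [CommRing A] [Nontrivial A] {f g : A[X]}
    (hf : f.Monic) (hn : 2 < f.natDegree) (hg : g.degree < f.degree) {q : (AdjoinRoot f)[X]}
    (hq : f.map (AdjoinRoot.of f) = (Polynomial.X - Polynomial.C (AdjoinRoot.root f)) * q)
    (hdvd : q ∣ g.map (AdjoinRoot.of f) - Polynomial.C (AdjoinRoot.mk f g)) :
    g = Polynomial.C (g.coeff 0) := by
  have hinj := AdjoinRoot.of_injective_of_monic hf (by omega)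
  have : Nontrivial (AdjoinRoot f) := hinj.nontrivial
  have hqm : q.Monic := .of_mul_monic_left (monic_X_sub_C _) (hq ▸ hf.map _)
  obtain ⟨n, hfn⟩ : ∃ n, f.natDegree = n + 3 := ⟨f.natDegree - 3, by omega⟩
  have hqn : q.natDegree = n + 2 := by
    have := hf.natDegree_map (AdjoinRoot.of f)
    rw [hq, (monic_X_sub_C _).natDegree_mul hqm, natDegree_X_sub_C] at this
    omega
  have hgn : g.natDegree ≤ n + 2 := by
    rw [degree_eq_natDegree hf.ne_zero, hfn] at hg
    exact natDegree_le_of_degree_le (Order.le_of_lt_succ hg)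
  obtain ⟨c, hc⟩ : ∃ c : AdjoinRoot f,
      g.map (AdjoinRoot.of f) - Polynomial.C (AdjoinRoot.mk f g) = q * Polynomial.C c := by
    obtain ⟨r, hr⟩ := hdvd
    have hr0 : r.natDegree = 0 := by
      by_cases h0 : r = 0
      · simp [h0]
      have h1 : (q * r).natDegree ≤ n + 2 := by
        rw [← hr]
        refine (natDegree_sub_C).le.trans (natDegree_map_le.trans hgn)
      rw [hqm.natDegree_mul' h0, hqn] at h1
      omega
    exact ⟨r.coeff 0, by rw [← eq_C_of_natDegree_eq_zero hr0, hr]⟩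
  have hcoeff (j : ℕ) : AdjoinRoot.of f (g.coeff (j + 1)) = q.coeff (j + 1) * c := by
    simpa [Polynomial.coeff_C] using congrArg (Polynomial.coeff · (j + 1)) hc
  have hc_eq : AdjoinRoot.of f (g.coeff (n + 2)) = c := by
    rw [hcoeff (n + 1), show q.coeff (n + 1 + 1) = 1 from hqn ▸ hqm.coeff_natDegree, one_mul]
  have hq_next : q.coeff (n + 1) =
      AdjoinRoot.of f (f.coeff (n + 2)) + AdjoinRoot.root f := by
    have h := congrArg (Polynomial.coeff · (n + 2)) hq
    simp only [Polynomial.coeff_map, sub_mul, Polynomial.coeff_sub, Polynomial.coeff_X_mul,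
      Polynomial.coeff_C_mul] at h
    rw [show q.coeff (n + 2) = 1 from hqn ▸ hqm.coeff_natDegree] at h
    rw [h]; ring
  have htop : g.coeff (n + 2) = 0 := by
    have h : AdjoinRoot.mk f (Polynomial.C (g.coeff (n + 2)) * Polynomial.X +
        Polynomial.C (f.coeff (n + 2) * g.coeff (n + 2) - g.coeff (n + 1))) = 0 := by
      have := hcoeff n
      rw [hq_next, ← hc_eq] at this
      simp only [map_add, map_mul, map_sub, AdjoinRoot.mk_C, AdjoinRoot.mk_X, this]
      ring
    by_contra h0
    refine AdjoinRoot.mk_ne_zero_of_natDegree_lt hf ?_ ?_ h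
    · exact fun h' => h0 (by simpa [Polynomial.coeff_C] using congrArg (Polynomial.coeff · 1) h')
    · exact natDegree_linear_le.trans_lt (by omega)
  ext j
  cases j with
  | zero => simp
  | succ j =>
    refine hinj ?_
    rw [hcoeff, ← hc_eq, htop]
    simp

/-- Every monic polynomial of degree at least three splits in an extension with two distinguished
roots at which no nonconstant polynomial of smaller degree takes the same value. -/
theorem exists_splits_eq_C_of_aeval_eq.{u} {A : Type u} [CommRing A] [Nontrivial A] {f : A[X]}
    (hf : f.Monic) (hn : 2 < f.natDegree) :
    ∃ (B : Type u) (_ : CommRing B) (_ : Algebra A B) (α β : B) (s : Multiset B),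
      f.map (algebraMap A B) = ((α ::ₘ β ::ₘ s).map fun r => Polynomial.X - Polynomial.C r).prod ∧
      ((α ::ₘ β ::ₘ s).card = f.natDegree) ∧
      ∀ g : A[X], g.degree < f.degree → Polynomial.aeval α g = Polynomial.aeval β g →
        g = Polynomial.C (g.coeff 0) := by
  have hinj := AdjoinRoot.of_injective_of_monic hf (by omega)
  have : Nontrivial (AdjoinRoot f) := hinj.nontrivial
  obtain ⟨q, hq⟩ : Polynomial.X - Polynomial.C (AdjoinRoot.root f) ∣ f.map (AdjoinRoot.of f) :=
    dvd_iff_isRoot.2 (AdjoinRoot.isRoot_root f)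
  have hqm : q.Monic := .of_mul_monic_left (monic_X_sub_C _) (hq ▸ hf.map _)
  have hqn : q.natDegree + 1 = f.natDegree := by
    rw [← hf.natDegree_map (AdjoinRoot.of f), hq, (monic_X_sub_C _).natDegree_mul hqm,
      natDegree_X_sub_C, add_comm]
  have hinjq := AdjoinRoot.of_injective_of_monic hqm (by omega)
  have : Nontrivial (AdjoinRoot q) := hinjq.nontrivial
  obtain ⟨r, hr⟩ : Polynomial.X - Polynomial.C (AdjoinRoot.root q) ∣ q.map (AdjoinRoot.of q) :=
    dvd_iff_isRoot.2 (AdjoinRoot.isRoot_root q)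
  have hrm : r.Monic := .of_mul_monic_left (monic_X_sub_C _) (hr ▸ hqm.map _)
  obtain ⟨B, _, _, _, _, _, hB⟩ := hrm.exists_splits_map
  have hinjB : Function.Injective (algebraMap (AdjoinRoot q) B) :=
    FaithfulSMul.algebraMap_injective _ _
  obtain ⟨s, hs⟩ := splits_iff_exists_multiset.1 hB
  rw [(hrm.map _).leadingCoeff, Polynomial.C_1, one_mul] at hs
  let φ : AdjoinRoot f →+* B := (algebraMap (AdjoinRoot q) B).comp (AdjoinRoot.of q)
  let _ : Algebra A B := (φ.comp (AdjoinRoot.of f)).toAlgebra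
  have hmap : f.map (algebraMap A B) =
      ((φ (AdjoinRoot.root f) ::ₘ algebraMap _ B (AdjoinRoot.root q) ::ₘ s).map
        fun r => Polynomial.X - Polynomial.C r).prod := by
    rw [RingHom.algebraMap_toAlgebra, ← Polynomial.map_map, hq, Polynomial.map_mul,
      ← Polynomial.map_map _ _ q, hr, Polynomial.map_mul, hs]
    simp [φ]
  refine ⟨B, _, _, φ (AdjoinRoot.root f), algebraMap _ B (AdjoinRoot.root q), s, hmap, ?_, ?_⟩
  · rw [← hf.natDegree_map (algebraMap A B), hmap, natDegree_multiset_prod_X_sub_C_eq_card]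
  · intro g hg h
    refine eq_C_of_dvd_map_sub_C_eval hf hn hg hq ?_
    have hα : Polynomial.aeval (φ (AdjoinRoot.root f)) g =
        algebraMap _ B (AdjoinRoot.of q (AdjoinRoot.mk f g)) := by
      rw [← AdjoinRoot.aeval_eq, Polynomial.aeval_def, Polynomial.aeval_def, ← RingHom.comp_apply,
        Polynomial.hom_eval₂]
      rfl
    have hβ : Polynomial.aeval (algebraMap _ B (AdjoinRoot.root q)) g =
        algebraMap _ B (AdjoinRoot.mk q (g.map (AdjoinRoot.of f))) := by
      rw [← AdjoinRoot.aeval_eq, Polynomial.aeval_def, Polynomial.aeval_def,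
        Polynomial.hom_eval₂, Polynomial.eval₂_map]
      rfl
    rw [← AdjoinRoot.mk_eq_zero, map_sub, AdjoinRoot.mk_C, sub_eq_zero]
    exact hinjB (by rw [← hα, ← hβ, h])

end splitting

section universalRoots

variable {A : Type*} [CommRing A] {n : ℕ} {a : Fin n → A}

theorem permHom_tau (σ : Equiv.Perm (Fin n)) (i : Fin n) :
    permHom A n a σ (tau A n a i) = tau A n a (σ i) := by
  change splittingMk A n a (rename σ (X i)) = _
  rw [rename_X]
  rfl

theorem aeval_tau (p : MvPolynomial (Fin n) A) :
    aeval (tau A n a) p = splittingMk A n a p := by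
  have : aeval (tau A n a) = splittingMk A n a := by
    ext i
    simp [tau]
  rw [this]

theorem prod_X_sub_C_tau :
    ∏ i, (Polynomial.X - Polynomial.C (tau A n a i)) =
      (monicOfCoeffs a).map (algebraMap A (SplittingAlg A n a)) := by
  refine prod_X_sub_C_eq_map_of_esymm fun k => ?_
  rw [aeval_tau, ← (splittingMk A n a).commutes]
  exact Ideal.Quotient.eq.2 (Ideal.subset_span ⟨k, rfl⟩)

theorem aeval_tau_monicOfCoeffs (i : Fin n) :
    Polynomial.aeval (tau A n a i) (monicOfCoeffs a) = 0 := by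
  rw [← Polynomial.eval_map_algebraMap, ← prod_X_sub_C_tau, Polynomial.eval_prod]
  exact Finset.prod_eq_zero (Finset.mem_univ i) (by simp)

/-- The universal property of the splitting algebra. -/
theorem exists_algHom_tau_eq {R : Type*} [CommRing R] [Algebra A R] {ρ : Fin n → R}
    (h : ∏ i, (Polynomial.X - Polynomial.C (ρ i)) =
      (monicOfCoeffs a).map (algebraMap A R)) :
    ∃ φ : SplittingAlg A n a →ₐ[A] R, ∀ i, φ (tau A n a i) = ρ i := by
  have hle : splittingIdeal A n a ≤ RingHom.ker (aeval ρ : MvPolynomial (Fin n) A →ₐ[A] R) := by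
    refine Ideal.span_le.2 ?_
    rintro _ ⟨k, rfl⟩
    simp only [SetLike.mem_coe, RingHom.mem_ker]
    rw [map_sub, aeval_esymm_of_prod_X_sub_C_eq_map h k, aeval_C, sub_self]
  refine ⟨Ideal.Quotient.liftₐ _ (aeval ρ) fun p hp => hle hp, fun i => ?_⟩
  exact aeval_X ρ i

end universalRoots

/-- For `n > 2`, every `S_n`-invariant element of `A_f` lying in
`Algebra.adjoin A {τ_{n-1}}` lies in the image of `algebraMap A A_f`. -/
theorem invariant_in_adjoin_last_root (A : Type*) [CommRing A] (n : ℕ) (hn : 2 < n)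
    (a : Fin n → A) (x : SplittingAlg A n a)
    (hinv : ∀ σ : Equiv.Perm (Fin n), permHom A n a σ x = x)
    (hadj : x ∈ Algebra.adjoin A {tau A n a ⟨n - 1, by omega⟩}) :
    x ∈ Set.range (algebraMap A (SplittingAlg A n a)) := by
  nontriviality A
  have hdeg := natDegree_monicOfCoeffs a
  rw [Algebra.adjoin_singleton_eq_range_aeval] at hadj
  obtain ⟨p, hp⟩ := hadj
  let g := p %ₘ monicOfCoeffs a
  have hg : g.degree < (monicOfCoeffs a).degree :=
    Polynomial.degree_modByMonic_lt _ (monicOfCoeffs_monic a)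
  have hxg (i : Fin n) : x = Polynomial.aeval (tau A n a i) g := by
    rw [← hinv (Equiv.swap ⟨n - 1, by omega⟩ i), ← hp]
    change permHom A n a _ (Polynomial.aeval _ p) = _
    rw [← Polynomial.aeval_algHom_apply, permHom_tau, Equiv.swap_apply_left]
    exact (Polynomial.aeval_modByMonic_eq_self_of_root (aeval_tau_monicOfCoeffs i)).symm
  obtain ⟨B, _, _, α, β, s, hB, hcard, hconst⟩ :=
    exists_splits_eq_C_of_aeval_eq (monicOfCoeffs_monic a) (by omega)
  have hlen : (α :: β :: s.toList).length = n := by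
    rw [← hdeg, ← hcard]
    simp
  let ρ : Fin n → B := fun i => (α :: β :: s.toList).get (i.cast hlen.symm)
  have hρ : ∏ i, (Polynomial.X - Polynomial.C (ρ i)) =
      (monicOfCoeffs a).map (algebraMap A B) := by
    rw [hB, ← Fintype.prod_equiv (finCongr hlen)
      (fun i => Polynomial.X - Polynomial.C ((α :: β :: s.toList).get i)) _ fun i => rfl,
      ← List.prod_ofFn]
    change (List.ofFn ((fun r => Polynomial.X - Polynomial.C r) ∘
      (α :: β :: s.toList).get)).prod = _
    rw [← List.map_ofFn, List.ofFn_get, ← Multiset.prod_coe, ← Multiset.map_coe,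
      ← Multiset.cons_coe, ← Multiset.cons_coe, Multiset.coe_toList]
  obtain ⟨φ, hφ⟩ := exists_algHom_tau_eq hρ
  have hval (i : Fin n) : φ x = Polynomial.aeval (ρ i) g := by
    rw [hxg i, ← Polynomial.aeval_algHom_apply, hφ]
  have hgC := hconst g hg ((hval ⟨0, by omega⟩).symm.trans (hval ⟨1, by omega⟩))
  refine ⟨g.coeff 0, ?_⟩
  rw [hxg ⟨0, by omega⟩, hgC, Polynomial.aeval_C, Polynomial.coeff_C_zero]
end

section
/- Assume n ≥ 2, let σ := Equiv.swap (n−2) (n−1) (transposing the last two indices of Fin n), and let H be the subgroup of S_n consisting of permutations fixing both n−2 and n−1. If there exists a nonzero a ∈ A with 2·a = 0 and (algebraMap A A_f a)·D_f = 0, then there exists x ∈ A_f such that x is invariant under σ, x is a trivial H-invariant, and x is not a trivial ⟨σ⟩-invariant. -/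
open MvPolynomial

namespace MvPolynomial

variable {ι R : Type*} [CommRing R]

theorem eq_zero_of_X_sub_X_mul_eq_zero {i j : ι} (hij : i ≠ j) {p : MvPolynomial ι R}
    (h : (X i - X j) * p = 0) : p = 0 := by
  classical
  let φ : MvPolynomial ι R →ₐ[R] MvPolynomial ι R := aeval (Function.update X i (X i + X j))
  let ψ : MvPolynomial ι R →ₐ[R] MvPolynomial ι R := aeval (Function.update X i (X i - X j))
  have hψφ : ψ.comp φ = AlgHom.id R _ := by
    refine algHom_ext fun k => ?_
    by_cases hk : k = i
    · subst hk
      simp [φ, ψ, Function.update_of_ne hij.symm]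
    · simp [φ, ψ, Function.update_of_ne hk]
  have hφ : X i * φ p = 0 := by
    have := congrArg φ h
    simpa [φ, Function.update_of_ne hij.symm] using this
  have hp : φ p = 0 := isRegular_X.left (hφ.trans (mul_zero (X i)).symm)
  simpa [hp] using (DFunLike.congr_fun hψφ p).symm

/-- The monic polynomial with roots the variables in `S`. -/
noncomputable def rootPoly (R : Type*) [CommRing R] (S : Finset ι) :
    Polynomial (MvPolynomial ι R) :=
  ∏ i ∈ S, (Polynomial.X - Polynomial.C (X i))

theorem rootPoly_monic (S : Finset ι) : (rootPoly R S).Monic :=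
  Polynomial.monic_prod_of_monic _ _ fun _ _ => Polynomial.monic_X_sub_C _

theorem natDegree_rootPoly [Nontrivial R] (S : Finset ι) : (rootPoly R S).natDegree = S.card := by
  simp [rootPoly, Polynomial.natDegree_finsetProd_X_sub_C_eq_card]

theorem map_rename_rootPoly (e : Equiv.Perm ι) {S : Finset ι} (he : ∀ i ∈ S, e i ∈ S) :
    (rootPoly R S).map (rename (R := R) e : MvPolynomial ι R →+* MvPolynomial ι R)
      = rootPoly R S := by
  simp only [rootPoly, Polynomial.map_prod, Polynomial.map_sub, Polynomial.map_X, Polynomial.map_C,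
    RingHom.coe_coe, rename_X]
  have hS : S.map e.toEmbedding = S :=
    Finset.eq_of_subset_of_card_le (fun i hi => by
      obtain ⟨j, hj, rfl⟩ := Finset.mem_map.1 hi
      exact he j hj) (by simp)
  conv_rhs => rw [← hS]
  simp

variable [DecidableEq ι]

theorem X_sub_X_dvd_sub_rename_swap (i j : ι) (p : MvPolynomial ι R) :
    X i - X j ∣ p - rename (Equiv.swap i j) p := by
  rw [← Ideal.mem_span_singleton, ← Ideal.Quotient.mk_eq_mk_iff_sub_mem]
  let I : Ideal (MvPolynomial ι R) := Ideal.span {X i - X j}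
  have hIJ : Ideal.Quotient.mk I (X i) = Ideal.Quotient.mk I (X j) :=
    Ideal.Quotient.mk_eq_mk_iff_sub_mem _ _ |>.2 (Ideal.mem_span_singleton_self _)
  have h : Ideal.Quotient.mkₐ R I = (Ideal.Quotient.mkₐ R I).comp (rename (Equiv.swap i j)) := by
    refine algHom_ext fun k => ?_
    rcases eq_or_ne k i with rfl | hi
    · simpa using hIJ
    rcases eq_or_ne k j with rfl | hj
    · simpa using hIJ.symm
    · simp [Equiv.swap_apply_of_ne_of_ne hi hj]
  exact DFunLike.congr_fun h p

/-- Ideals closed under the divided differences attached to transpositions of variables. -/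
def IsDividedDifferenceStable (J : Ideal (MvPolynomial ι R)) : Prop :=
  ∀ i j : ι, ∀ p ∈ J, ∃ q ∈ J, p - rename (Equiv.swap i j) p = (X i - X j) * q

/-- Newton interpolation: a polynomial of degree less than `#S` whose coefficients are symmetric
in the variables of `S` has its coefficients in `J` as soon as its values at these variables
are in `J`. -/
theorem coeff_mem_of_eval_X_mem {J : Ideal (MvPolynomial ι R)} (hJ : IsDividedDifferenceStable J)
    (S : Finset ι) (h : Polynomial (MvPolynomial ι R))
    (hdeg : ∀ m, S.card ≤ m → h.coeff m = 0)
    (hinv : ∀ i ∈ S, ∀ j ∈ S,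
      h.map (rename (R := R) (Equiv.swap i j) : MvPolynomial ι R →+* MvPolynomial ι R) = h)
    (heval : ∀ i ∈ S, h.eval (X i) ∈ J) (k : ℕ) : h.coeff k ∈ J := by
  induction S using Finset.induction generalizing h k with
  | empty => simp [hdeg k (by simp)]
  | insert a S ha ih =>
    set g := h /ₘ (Polynomial.X - Polynomial.C (X a)) with hg
    have hdecomp : h = Polynomial.C (h.eval (X a)) +
        (Polynomial.X - Polynomial.C (X a)) * g := by
      rw [← Polynomial.modByMonic_X_sub_C_eq_C_eval, Polynomial.modByMonic_add_div]
    have hgJ : ∀ k, g.coeff k ∈ J := by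
      refine ih g ?_ ?_ ?_
      · intro m hm
        rw [hg, Polynomial.coeff_divByMonic_X_sub_C]
        refine Finset.sum_eq_zero fun l hl => ?_
        rw [hdeg l (by rw [Finset.card_insert_of_notMem ha]; grind), mul_zero]
      · intro i hi j hj
        rw [hg, Polynomial.map_divByMonic _ (Polynomial.monic_X_sub_C _),
          hinv i (Finset.mem_insert_of_mem hi) j (Finset.mem_insert_of_mem hj)]
        have : Equiv.swap i j a = a := Equiv.swap_apply_of_ne_of_ne (by grind) (by grind)
        simp [this]
      · intro i hi
        have hia : i ≠ a := by grind
        obtain ⟨q, hq, hqe⟩ := hJ i a _ (heval i (Finset.mem_insert_of_mem hi))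
        have hswap : rename (Equiv.swap i a) (h.eval (X i)) = h.eval (X a) := by
          have := Polynomial.eval_map_apply (p := h)
            (f := (rename (R := R) (Equiv.swap i a) : MvPolynomial ι R →+* MvPolynomial ι R)) (X i)
          rw [hinv i (Finset.mem_insert_of_mem hi) a (Finset.mem_insert_self _ _)] at this
          simpa using this.symm
        have hval := congrArg (Polynomial.eval (X i)) hdecomp
        simp only [Polynomial.eval_add, Polynomial.eval_C, Polynomial.eval_mul,
          Polynomial.eval_sub, Polynomial.eval_X] at hval
        have : g.eval (X i) = q := by
          rw [← sub_eq_zero]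
          refine eq_zero_of_X_sub_X_mul_eq_zero (R := R) hia ?_
          rw [mul_sub, ← hqe, hswap]
          linear_combination -hval
        rwa [this]
    have hpoly : (Polynomial.C (h.eval (X a)) + (Polynomial.X - Polynomial.C (X a)) * g).coeff k
        ∈ J := by
      rw [Polynomial.coeff_add, sub_mul, Polynomial.coeff_sub, Polynomial.coeff_C_mul,
        Polynomial.coeff_C]
      refine J.add_mem ?_ (J.sub_mem ?_ (J.mul_mem_left _ (hgJ k)))
      · split_ifs
        exacts [heval a (Finset.mem_insert_self _ _), J.zero_mem]
      · cases k with
        | zero => simp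
        | succ k => simpa using hgJ k
    rwa [← hdecomp] at hpoly

theorem exists_eval_X_eq (T : Set (MvPolynomial ι R)) {a : ι} {S : Finset ι} (ha : a ∉ S)
    {y : MvPolynomial ι R}
    (hy : y ∈ Algebra.adjoin R (insert (X a) T ∪ Set.range (rootPoly R S).coeff)) :
    ∃ h : Polynomial (MvPolynomial ι R),
      (∀ k, h.coeff k ∈ Algebra.adjoin R (T ∪ Set.range (rootPoly R (insert a S)).coeff)) ∧
      (∀ m, (insert a S).card ≤ m → h.coeff m = 0) ∧ h.eval (X a) = y := by
  nontriviality R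
  set Q := Algebra.adjoin R (T ∪ Set.range (rootPoly R (insert a S)).coeff) with hQ
  let ev : Polynomial Q →ₐ[R] MvPolynomial ι R := (Polynomial.aeval (X a)).restrictScalars R
  have hQev : ∀ q ∈ Q, q ∈ ev.range := fun q hq =>
    ⟨Polynomial.C ⟨q, hq⟩, by simp [ev]⟩
  have hXev : X a ∈ ev.range := ⟨Polynomial.X, by simp [ev]⟩
  have hmul : rootPoly R (insert a S) =
      (Polynomial.X - Polynomial.C (X a)) * rootPoly R S := Finset.prod_insert ha
  have hle : Algebra.adjoin R (insert (X a) T ∪ Set.range (rootPoly R S).coeff) ≤ ev.range := by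
    refine Algebra.adjoin_le ?_
    rintro x ((rfl | hx) | ⟨k, rfl⟩)
    · exact hXev
    · exact hQev _ (Algebra.subset_adjoin (Or.inl hx))
    · have : rootPoly R S = rootPoly R (insert a S) /ₘ (Polynomial.X - Polynomial.C (X a)) := by
        rw [hmul, Polynomial.mul_divByMonic_cancel_left _ (Polynomial.monic_X_sub_C _)]
      rw [SetLike.mem_coe, this, Polynomial.coeff_divByMonic_X_sub_C]
      refine sum_mem fun i _ => mul_mem (pow_mem hXev _) (hQev _ (Algebra.subset_adjoin ?_))
      exact Or.inr ⟨i, rfl⟩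
  obtain ⟨h, rfl⟩ := hle hy
  obtain ⟨g, hgmap, hgdeg, hgmonic⟩ := Polynomial.lifts_and_natDegree_eq_and_monic
    (f := algebraMap Q (MvPolynomial ι R)) (p := rootPoly R (insert a S))
    ((Polynomial.lifts_iff_coeff_lifts _).2 fun k =>
      ⟨⟨_, Algebra.subset_adjoin (Or.inr ⟨k, rfl⟩)⟩, rfl⟩) (rootPoly_monic _)
  refine ⟨(h %ₘ g).map (algebraMap Q _), fun k => ?_, fun m hm => ?_, ?_⟩
  · rw [Polynomial.coeff_map]
    exact ((h %ₘ g).coeff k).2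
  · rw [Polynomial.coeff_map, Polynomial.coeff_eq_zero_of_degree_lt, map_zero]
    refine (Polynomial.degree_modByMonic_lt _ hgmonic).trans_le ?_
    rw [Polynomial.degree_eq_natDegree hgmonic.ne_zero, hgdeg, natDegree_rootPoly]
    exact_mod_cast hm
  · have hroot : Polynomial.aeval (X a : MvPolynomial ι R) g = 0 := by
      rw [Polynomial.aeval_def, ← Polynomial.eval_map, hgmap, hmul]
      simp
    rw [Polynomial.eval_map, ← Polynomial.aeval_def,
      Polynomial.aeval_modByMonic_eq_self_of_root hroot]
    rfl

/-- If an ideal `J` is stable under divided differences, the existence of elements outside `J` that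
are multiplied into `J` by `E` descends from a subalgebra generated by the variables in `S`
and other `S`-symmetric elements to its part generated by `S`-symmetric elements. -/
theorem exists_notMem_of_exists_notMem_adjoin {J : Ideal (MvPolynomial ι R)}
    (hJ : IsDividedDifferenceStable J) (S : Finset ι) (E T : Set (MvPolynomial ι R))
    (hE : ∀ t ∈ E, ∀ i ∈ S, ∀ j ∈ S, rename (Equiv.swap i j) t = t)
    (hT : ∀ t ∈ T, ∀ i ∈ S, ∀ j ∈ S, rename (Equiv.swap i j) t = t)
    (h : ∃ y ∈ Algebra.adjoin R (T ∪ X '' (S : Set ι)), y ∉ J ∧ ∀ t ∈ E, t * y ∈ J) :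
    ∃ y ∈ Algebra.adjoin R (T ∪ Set.range (rootPoly R S).coeff),
      y ∉ J ∧ ∀ t ∈ E, t * y ∈ J := by
  induction S using Finset.induction generalizing T with
  | empty =>
    obtain ⟨y, hy, hyJ⟩ := h
    exact ⟨y, Algebra.adjoin_mono (by simp) hy, hyJ⟩
  | insert a S ha ih =>
    obtain ⟨y, hy, hyJ, hEy⟩ := ih (insert (X a) T)
      (fun t ht i hi j hj =>
        hE t ht i (Finset.mem_insert_of_mem hi) j (Finset.mem_insert_of_mem hj))
      (by
        rintro t (rfl | ht) i hi j hj
        · rw [rename_X, Equiv.swap_apply_of_ne_of_ne] <;> grind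
        · exact hT t ht i (Finset.mem_insert_of_mem hi) j (Finset.mem_insert_of_mem hj))
      (by
        convert h using 4
        rw [Finset.coe_insert, Set.image_insert_eq, Set.insert_union, Set.union_insert])
    obtain ⟨f, hfQ, hfdeg, rfl⟩ := exists_eval_X_eq T ha hy
    have hQinv : ∀ q ∈ Algebra.adjoin R (T ∪ Set.range (rootPoly R (insert a S)).coeff),
        ∀ i ∈ insert a S, ∀ j ∈ insert a S, rename (Equiv.swap i j) q = q := by
      intro q hq i hi j hj
      have : Algebra.adjoin R (T ∪ Set.range (rootPoly R (insert a S)).coeff) ≤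
          AlgHom.equalizer (rename (Equiv.swap i j)) (AlgHom.id R _) := by
        refine Algebra.adjoin_le ?_
        rintro x (hx | ⟨k, rfl⟩)
        · exact hT x hx i hi j hj
        · have := congrArg (Polynomial.coeff · k) (map_rename_rootPoly (R := R)
            (Equiv.swap i j) (S := insert a S) fun l hl => by
              rw [Equiv.swap_apply_def]; split_ifs <;> assumption)
          simpa using this
      exact this hq
    have hk : ∃ k, f.coeff k ∉ J := by
      by_contra! hf
      exact hyJ (by rw [Polynomial.eval_eq_sum]; exact sum_mem fun k _ => J.mul_mem_right _ (hf k))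
    obtain ⟨k, hk⟩ := hk
    refine ⟨f.coeff k, hfQ k, hk, fun t ht => ?_⟩
    have hinv : ∀ i ∈ insert a S, ∀ j ∈ insert a S, (Polynomial.C t * f).map
        (rename (R := R) (Equiv.swap i j) : MvPolynomial ι R →+* MvPolynomial ι R)
          = Polynomial.C t * f := by
      intro i hi j hj
      ext1 l
      simp only [Polynomial.coeff_map, Polynomial.coeff_C_mul, RingHom.coe_coe, map_mul]
      rw [hE t ht i hi j hj, hQinv _ (hfQ l) i hi j hj]
    rw [← Polynomial.coeff_C_mul]
    refine coeff_mem_of_eval_X_mem hJ (insert a S) _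
      (fun m hm => by rw [Polynomial.coeff_C_mul, hfdeg m hm, mul_zero]) hinv (fun i hi => ?_) k
    have haJ : (Polynomial.C t * f).eval (X a) ∈ J := by simpa using hEy t ht
    obtain ⟨q, hq, hqe⟩ := hJ a i _ haJ
    have hswap : rename (Equiv.swap a i) ((Polynomial.C t * f).eval (X a)) =
        (Polynomial.C t * f).eval (X i) := by
      have := Polynomial.eval_map_apply (p := Polynomial.C t * f)
        (f := (rename (R := R) (Equiv.swap a i) : MvPolynomial ι R →+* MvPolynomial ι R)) (X a)
      rw [hinv a (Finset.mem_insert_self _ _) i hi] at this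
      simpa using this.symm
    rw [← hswap, ← sub_sub_cancel ((Polynomial.C t * f).eval (X a)) (rename _ _), hqe]
    exact J.sub_mem haJ (J.mul_mem_left _ hq)

end MvPolynomial

section SplittingAlgebra

variable {A : Type*} [CommRing A] {n : ℕ} {a : Fin n → A}

theorem splittingMk_eq_zero_iff {p : MvPolynomial (Fin n) A} :
    splittingMk A n a p = 0 ↔ p ∈ splittingIdeal A n a :=
  Ideal.Quotient.eq_zero_iff_mem

theorem permHom_splittingMk (e : Equiv.Perm (Fin n)) (p : MvPolynomial (Fin n) A) :
    permHom A n a e (splittingMk A n a p) = splittingMk A n a (rename e p) :=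
  rfl

theorem isDividedDifferenceStable_splittingIdeal :
    IsDividedDifferenceStable (splittingIdeal A n a) := by
  intro i j p hp
  induction hp using Submodule.span_induction with
  | mem x hx =>
    obtain ⟨k, rfl⟩ := hx
    refine ⟨0, zero_mem _, ?_⟩
    simp [(esymm_isSymmetric (Fin n) A (k.1 + 1)) (Equiv.swap i j)]
  | zero => exact ⟨0, zero_mem _, by simp⟩
  | add x y _ _ hx hy =>
    obtain ⟨q, hq, hqe⟩ := hx
    obtain ⟨r, hr, hre⟩ := hy
    exact ⟨q + r, add_mem hq hr, by rw [map_add]; linear_combination hqe + hre⟩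
  | smul r x hx ih =>
    obtain ⟨q, hq, hqe⟩ := ih
    obtain ⟨c, hc⟩ := X_sub_X_dvd_sub_rename_swap i j r
    refine ⟨r * q + c * rename (Equiv.swap i j) x, add_mem (Ideal.mul_mem_left _ _ hq)
      (Ideal.mul_mem_left _ _ (rename_mem_splittingIdeal A n a _ hx)), ?_⟩
    rw [smul_eq_mul, map_mul]
    linear_combination r * hqe + rename (Equiv.swap i j) x * hc

theorem eq_zero_of_C_mem_splittingIdeal {b : A} (hb : C b ∈ splittingIdeal A n a) : b = 0 := by
  nontriviality A
  let f : Polynomial A :=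
    Polynomial.X ^ n + ∑ i : Fin n, Polynomial.C (a i.rev) * Polynomial.X ^ (i : ℕ)
  have hdeg : (∑ i : Fin n, Polynomial.C (a i.rev) * Polynomial.X ^ (i : ℕ)).degree <
      (n : WithBot ℕ) :=
    Polynomial.degree_sum_fin_lt fun i : Fin n => a i.rev
  have hf : f.Monic := Polynomial.monic_X_pow_add hdeg
  have hfdeg : f.natDegree = n := by
    refine Polynomial.natDegree_eq_of_degree_eq_some ?_
    rw [Polynomial.degree_add_eq_left_of_degree_lt] <;> simp [hdeg]
  obtain ⟨S, _, _, _, _, _, hS⟩ := hf.exists_splits_map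
  obtain ⟨m, hm⟩ := Polynomial.splits_iff_exists_multiset.1 hS
  rw [(hf.map _).leadingCoeff, map_one, one_mul] at hm
  have hcard : m.card = n := by
    rw [← hfdeg, ← hf.natDegree_map (algebraMap A S), hm,
      Polynomial.natDegree_multiset_prod_X_sub_C_eq_card]
  obtain ⟨r, hr⟩ : ∃ r : Fin n → S, Finset.univ.val.map r = m := by
    subst hcard
    induction m using Quotient.inductionOn with
    | h l => exact ⟨l.get, (Fin.univ_val_map l.get).trans (congrArg _ (List.ofFn_get l))⟩
  have hker : splittingIdeal A n a ≤ RingHom.ker (aeval (R := A) r) := by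
    refine Ideal.span_le.2 ?_
    rintro _ ⟨k, rfl⟩
    have hk := congrArg (Polynomial.coeff · (n - (k + 1))) hm
    simp only [Polynomial.coeff_map] at hk
    rw [Multiset.prod_X_sub_C_coeff _ (by omega), hcard] at hk
    have hcoeff : f.coeff (n - (k + 1)) = a k := by
      rw [Polynomial.coeff_add, Polynomial.coeff_X_pow, if_neg (by omega), zero_add,
        Polynomial.finsetSum_coeff, Finset.sum_eq_single k.rev]
      · simp [Fin.val_rev]
      · intro i _ hi
        rw [Polynomial.coeff_C_mul_X_pow, if_neg]
        rintro h
        exact hi (Fin.ext (by rw [Fin.val_rev, h]))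
      · simp
    rw [SetLike.mem_coe, RingHom.mem_ker, map_sub, aeval_esymm_eq_multiset_esymm, hr, aeval_C]
    rw [hcoeff, show n - (n - (k + 1)) = k + 1 by omega] at hk
    rw [map_mul, hk, map_pow, map_neg, map_one, ← mul_assoc, ← mul_pow]
    simp
  have := hker hb
  rw [RingHom.mem_ker, aeval_C] at this
  exact (FaithfulSMul.algebraMap_eq_zero_iff A S).1 this

/-- If `D_f` is killed by a nonzero `2`-torsion constant, then `Xᵢ + Xⱼ` is a zero divisor on the
`2`-torsion of the splitting algebra. -/
theorem exists_notMem_X_add_X_mul_mem {i j : Fin n} (hij : i ≠ j) {b : A} (hb : b ≠ 0)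
    (h2 : 2 * b = 0) (hD : algebraMap A (SplittingAlg A n a) b * Df A n a = 0) :
    ∃ y, y ∉ splittingIdeal A n a ∧ 2 * y ∈ splittingIdeal A n a ∧
      (X i + X j) * y ∈ splittingIdeal A n a := by
  set J := splittingIdeal A n a
  have hprod : ∀ F : Finset (Fin n × Fin n), (∀ e ∈ F, e.1 ≠ e.2) →
      C b * ∏ e ∈ F, (X e.1 + X e.2 : MvPolynomial (Fin n) A) ∈ J →
      ∃ e : Fin n × Fin n, e.1 ≠ e.2 ∧ ∃ y, y ∉ J ∧ 2 * y ∈ J ∧ (X e.1 + X e.2) * y ∈ J := by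
    intro F hF hmem
    induction F using Finset.induction with
    | empty => exact absurd (eq_zero_of_C_mem_splittingIdeal (by simpa using hmem)) hb
    | insert e F he ih =>
      by_cases hFJ : C b * ∏ e ∈ F, (X e.1 + X e.2 : MvPolynomial (Fin n) A) ∈ J
      · exact ih (fun e he => hF e (Finset.mem_insert_of_mem he)) hFJ
      · refine ⟨e, hF e (Finset.mem_insert_self _ _), _, hFJ, ?_, ?_⟩
        · rw [← mul_assoc, show (2 : MvPolynomial (Fin n) A) * C b = 0 by
            rw [← map_ofNat C 2, ← map_mul, h2, map_zero], zero_mul]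
          exact zero_mem _
        · rwa [Finset.prod_insert he, mul_left_comm] at hmem
  obtain ⟨⟨k, l⟩, hkl, y, hyJ, hy2, hy⟩ := hprod
    (Finset.univ.filter fun p : Fin n × Fin n => p.1 < p.2) (fun e he => by grind) (by
      rw [← splittingMk_eq_zero_iff, map_mul, map_prod, ← hD]
      simp only [map_add]
      rfl)
  obtain ⟨e, hek, hel⟩ : ∃ e : Equiv.Perm (Fin n), e k = i ∧ e l = j := by
    refine ⟨(Equiv.swap k i).trans (Equiv.swap (Equiv.swap k i l) j), ?_, by simp⟩
    simp only [Equiv.trans_apply, Equiv.swap_apply_left]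
    exact Equiv.swap_apply_of_ne_of_ne (by
      intro h
      exact hkl ((Equiv.swap k i).injective (by simpa using h))) hij
  refine ⟨rename e y, fun h => hyJ ?_, ?_, ?_⟩
  · have := rename_mem_splittingIdeal A n a e.symm h
    rwa [rename_rename, ← Equiv.coe_trans, Equiv.self_trans_symm, Equiv.coe_refl, rename_id_apply]
      at this
  · simpa only [map_mul, map_ofNat] using rename_mem_splittingIdeal A n a e hy2
  · simpa [hek, hel] using rename_mem_splittingIdeal A n a e hy

/-- The trivial invariants of a transposition contain no `d * Xⱼ` with `d` symmetric, unless `d` is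
zero in the splitting algebra. -/
theorem splittingMk_mul_X_notMem_trivialInv {i j : Fin n} (hij : i ≠ j)
    {d : MvPolynomial (Fin n) A} (hd : d ∉ splittingIdeal A n a)
    (hswap : rename (Equiv.swap i j) d = d) {G : Subgroup (Equiv.Perm (Fin n))}
    (hG : Equiv.swap i j ∈ G) : splittingMk A n a (d * X j) ∉ trivialInv A n a G := by
  rintro ⟨q, hq, hqd⟩
  obtain ⟨r, hr, hre⟩ := isDividedDifferenceStable_splittingIdeal i j (q - d * X j)
    (by rw [← splittingMk_eq_zero_iff, map_sub, hqd, sub_self])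
  rw [map_sub, map_mul, hq _ hG, hswap, rename_X, Equiv.swap_apply_right] at hre
  have : d - r = 0 := eq_zero_of_X_sub_X_mul_eq_zero (R := A) hij (by linear_combination hre)
  exact hd (sub_eq_zero.1 this ▸ hr)

theorem exists_swap_invariant_of_mul_eq_zero {i j : Fin n} (hij : i ≠ j)
    (h : ∃ y, y ∉ splittingIdeal A n a ∧ 2 * y ∈ splittingIdeal A n a ∧
      (X i + X j) * y ∈ splittingIdeal A n a) :
    ∃ x : SplittingAlg A n a, permHom A n a (Equiv.swap i j) x = x ∧
      x ∈ trivialInv A n a (MulAction.stabilizer (Equiv.Perm (Fin n)) i ⊓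
        MulAction.stabilizer (Equiv.Perm (Fin n)) j) ∧
      x ∉ trivialInv A n a (Subgroup.closure {Equiv.swap i j}) := by
  let U : Finset (Fin n) := {i, j}
  let E : Set (MvPolynomial (Fin n) A) := {2, X i + X j}
  have hsymm : ∀ (V : Finset (Fin n)) (e : Equiv.Perm (Fin n)), (∀ k ∈ V, e k ∈ V) →
      ∀ t ∈ Set.range (rootPoly A V).coeff, rename e t = t := by
    rintro V e he _ ⟨k, rfl⟩
    simpa using congrArg (Polynomial.coeff · k) (map_rename_rootPoly (R := A) e he)
  obtain ⟨y, hyJ, hy2, hy⟩ := h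
  have hJ : IsDividedDifferenceStable (splittingIdeal A n a) :=
    isDividedDifferenceStable_splittingIdeal
  have htop : Algebra.adjoin A (X '' (U : Set (Fin n)) ∪ X '' ((Uᶜ : Finset _) : Set (Fin n)))
      = (⊤ : Subalgebra A (MvPolynomial (Fin n) A)) := by
    rw [← Set.image_union, Finset.coe_compl, Set.union_compl_self, Set.image_univ,
      adjoin_range_X]
  have hUc : ∀ k ∈ Uᶜ, k ≠ i ∧ k ≠ j := fun k hk => by simpa [U] using hk
  obtain ⟨z, hz, hzJ⟩ := exists_notMem_of_exists_notMem_adjoin hJ Uᶜ E (X '' (U : Set (Fin n)))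
    (by
      rintro t (rfl | rfl) k hk l hl
      · exact map_ofNat _ 2
      · rw [map_add, rename_X, rename_X, Equiv.swap_apply_of_ne_of_ne,
          Equiv.swap_apply_of_ne_of_ne] <;> grind)
    (by
      rintro _ ⟨m, hm, rfl⟩ k hk l hl
      rw [rename_X, Equiv.swap_apply_of_ne_of_ne] <;> rintro rfl
      exacts [Finset.mem_compl.1 hk hm, Finset.mem_compl.1 hl hm])
    ⟨y, by rw [htop]; trivial, hyJ, by rintro t (rfl | rfl) <;> assumption⟩
  obtain ⟨d, hd, hdJ, hdE⟩ := exists_notMem_of_exists_notMem_adjoin hJ U E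
    (Set.range (rootPoly A Uᶜ).coeff)
    (by
      rintro t (rfl | rfl) k hk l hl
      · exact map_ofNat _ 2
      · rw [map_add, rename_X, rename_X]
        simp only [U, Finset.mem_insert, Finset.mem_singleton] at hk hl
        rcases hk with rfl | rfl <;> rcases hl with rfl | rfl <;> simp [add_comm])
    (fun t ht k hk l hl => hsymm Uᶜ _ (fun m hm => by
        rwa [Equiv.swap_apply_of_ne_of_ne] <;> rintro rfl
        exacts [Finset.mem_compl.1 hm hk, Finset.mem_compl.1 hm hl])
      t ht)
    ⟨z, by rwa [Set.union_comm] at hz, hzJ⟩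
  have hdinv : ∀ e : Equiv.Perm (Fin n), (∀ k, e k ∈ U ↔ k ∈ U) → rename e d = d := by
    intro e he
    have hle : Algebra.adjoin A (Set.range (rootPoly A Uᶜ).coeff ∪ Set.range (rootPoly A U).coeff)
        ≤ AlgHom.equalizer (rename e) (AlgHom.id A _) := by
      refine Algebra.adjoin_le (Set.union_subset (fun t ht => ?_) fun t ht => ?_)
      · exact hsymm Uᶜ e (by simp [he]) t ht
      · exact hsymm U e (by simp [he]) t ht
    exact hle hd
  have hdswap : rename (Equiv.swap i j) d = d := hdinv _ fun k => by
    rw [Equiv.swap_apply_def]; grind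
  refine ⟨splittingMk A n a (d * X j), ?_, ⟨d * X j, ?_, rfl⟩,
    splittingMk_mul_X_notMem_trivialInv hij hdJ hdswap (Subgroup.subset_closure rfl)⟩
  · rw [permHom_splittingMk, ← sub_eq_zero, ← map_sub, splittingMk_eq_zero_iff, map_mul, hdswap,
      rename_X, Equiv.swap_apply_right]
    have : d * X i - d * X j = (X i + X j) * d - X j * (2 * d) := by ring
    rw [this]
    exact sub_mem (hdE _ (by simp [E])) (Ideal.mul_mem_left _ _ (hdE _ (by simp [E])))
  · rintro e ⟨hei, hej⟩
    replace hei : e i = i := hei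
    replace hej : e j = j := hej
    rw [map_mul, rename_X, hej, hdinv e fun k => ?_]
    have h1 : e k = i ↔ k = i := by rw [← e.injective.eq_iff (a := k), hei]
    have h2 : e k = j ↔ k = j := by rw [← e.injective.eq_iff (a := k), hej]
    simp [U, h1, h2]

end SplittingAlgebra

/-- For `n ≥ 2`, `σ := Equiv.swap (n-2) (n-1)` and `H` the subgroup of
permutations fixing `n-2` and `n-1`: if there is a nonzero `a ∈ A` with `2·a = 0` and
`(algebraMap A A_f a)·D_f = 0`, then there exists `x ∈ A_f` invariant under `σ`, a trivial
`H`-invariant, and not a trivial `⟨σ⟩`-invariant. -/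
theorem exists_nontrivial_swap_invariant (A : Type*) [CommRing A] (n : ℕ) (hn : 2 ≤ n)
    (a : Fin n → A)
    (hann : ∃ b : A, b ≠ 0 ∧ 2 * b = 0 ∧ algebraMap A (SplittingAlg A n a) b * Df A n a = 0) :
    ∃ x : SplittingAlg A n a,
      permHom A n a (Equiv.swap (⟨n - 2, by omega⟩ : Fin n) ⟨n - 1, by omega⟩) x = x ∧
      x ∈ trivialInv A n a
        (MulAction.stabilizer (Equiv.Perm (Fin n)) (⟨n - 2, by omega⟩ : Fin n) ⊓
         MulAction.stabilizer (Equiv.Perm (Fin n)) (⟨n - 1, by omega⟩ : Fin n)) ∧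
      x ∉ trivialInv A n a
        (Subgroup.closure {Equiv.swap (⟨n - 2, by omega⟩ : Fin n) ⟨n - 1, by omega⟩}) := by
  obtain ⟨b, hb, h2, hD⟩ := hann
  have hne : (⟨n - 2, by omega⟩ : Fin n) ≠ ⟨n - 1, by omega⟩ := by
    rw [Ne, Fin.mk.injEq]; omega
  exact exists_swap_invariant_of_mul_eq_zero hne (exists_notMem_X_add_X_mul_mem hne hb h2 hD)
end
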